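/- Let p, q, r be distinct primes, n a positive integer, N = p^n·q·r, and let (A,B) be a spectral pair in Z_N satisfying the standing assumptions. Then at least one of the residues p^n·q and p^n·r lies in Z_B. -/

import Mathlib

open Finset

/-- `chi N A b = ∑_{a ∈ A} e^{2πi·ab/N}`. -/
noncomputable def chi (N : ℕ) (A : Finset (ZMod N)) (b : ZMod N) : ℂ :=
  ∑ a ∈ A, Complex.exp (2 * Real.pi * Complex.I * ((a * b).val : ℕ) / N)

/-- `(A, B)` is a spectral pair in `Z_N`. -/
def IsSpectralPair (N : ℕ) (A B : Finset (ZMod N)) : Prop :=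
  A.card = B.card ∧ ∀ b ∈ B, ∀ b' ∈ B, b ≠ b' → chi N A (b - b') = 0

/-- `A` tiles `Z_N` by translation. -/
def Tiles (N : ℕ) (A : Finset (ZMod N)) : Prop :=
  ∃ T : Finset (ZMod N), ∀ g : ZMod N,
    ∃! x : ZMod N × ZMod N, x.1 ∈ A ∧ x.2 ∈ T ∧ x.1 + x.2 = g

/-- `A` is a union of cosets of the subgroup `{x : m·x = 0}` of `Z_N`
(for `m` a prime divisor of `N` this is the unique subgroup of order `m`). -/
def IsUnionOfCosets (N : ℕ) (m : ℕ) (A : Finset (ZMod N)) : Prop :=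
  ∀ a ∈ A, ∀ x : ZMod N, (m : ZMod N) * x = 0 → a + x ∈ A

/-- All characters of order `m` annihilate `A`. -/
def VanishesAt {N : ℕ} [NeZero N] (A : Finset (ZMod N)) (m : ℕ) : Prop :=
  ∀ s : ZMod N, addOrderOf s = m → ∑ a ∈ A, ZMod.stdAddChar (s * a) = 0

/-- The span of the characters of order `m` in the space of functions on `Z_N`. -/
def primSpan (N : ℕ) [NeZero N] (m : ℕ) : Submodule ℂ (ZMod N → ℂ) :=
  Submodule.span ℂ {f | ∃ s : ZMod N, addOrderOf s = m ∧ f = fun a => ZMod.stdAddChar (s * a)}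

/-- The reduction of a residue modulo `N` to a residue modulo `d`. -/
def residue {N : ℕ} (d : ℕ) (a : ZMod N) : ZMod d := (a.val : ZMod d)

/-- The indicator function of the class `c` modulo `d`. -/
def ind {N : ℕ} (d : ℕ) (c : ZMod d) (a : ZMod N) : ℤ := if residue d a = c then 1 else 0

theorem residue_zero {N : ℕ} (d : ℕ) : residue d (0 : ZMod N) = 0 := by
  simp [residue]

theorem residue_eq_zero_iff {N : ℕ} (d : ℕ) (a : ZMod N) : residue d a = 0 ↔ d ∣ a.val := by
  rw [residue, ZMod.natCast_eq_zero_iff]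

section Characters

variable {N : ℕ} [NeZero N]

theorem chi_eq_sum_stdAddChar (A : Finset (ZMod N)) (b : ZMod N) :
    chi N A b = ∑ a ∈ A, ZMod.stdAddChar (b * a) := by
  refine Finset.sum_congr rfl fun a _ => ?_
  rw [ZMod.stdAddChar_apply, ZMod.toCircle_apply, mul_comm b a]

theorem isPrimitiveRoot_stdAddChar (s : ZMod N) :
    IsPrimitiveRoot (ZMod.stdAddChar s : ℂ) (addOrderOf s) := by
  refine IsPrimitiveRoot.mk_of_lt _ (addOrderOf_pos s) ?_ fun l hl0 hl h => ?_
  · rw [← AddChar.map_nsmul_eq_pow, addOrderOf_nsmul_eq_zero, AddChar.map_zero_eq_one]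
  · rw [← AddChar.map_nsmul_eq_pow, ← AddChar.map_zero_eq_one (ZMod.stdAddChar (N := N))] at h
    exact (Nat.le_of_dvd hl0 (addOrderOf_dvd_of_nsmul_eq_zero
      (ZMod.injective_stdAddChar h))).not_gt hl

theorem sum_stdAddChar_eq_zero_of_addOrderOf_eq (A : Finset (ZMod N)) (s t : ZMod N)
    (hst : addOrderOf s = addOrderOf t) (h : ∑ a ∈ A, (ZMod.stdAddChar (s * a) : ℂ) = 0) :
    ∑ a ∈ A, (ZMod.stdAddChar (t * a) : ℂ) = 0 := by
  have key : ∀ u : ZMod N, ∑ a ∈ A, (ZMod.stdAddChar (u * a) : ℂ) =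
      Polynomial.aeval (ZMod.stdAddChar u : ℂ)
        (∑ a ∈ A, (Polynomial.X : Polynomial ℚ) ^ a.val) := by
    intro u
    rw [map_sum]
    refine Finset.sum_congr rfl fun a _ => ?_
    rw [map_pow, Polynomial.aeval_X, ← AddChar.map_nsmul_eq_pow, nsmul_eq_mul,
      ZMod.natCast_zmod_val, mul_comm]
  rw [key] at h ⊢
  have hs := Polynomial.cyclotomic_eq_minpoly_rat (isPrimitiveRoot_stdAddChar s)
    (addOrderOf_pos s)
  have ht := Polynomial.cyclotomic_eq_minpoly_rat (isPrimitiveRoot_stdAddChar t)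
    (addOrderOf_pos t)
  obtain ⟨Q, hQ⟩ := minpoly.dvd ℚ _ h
  rw [hQ, ← hs, hst, ht, map_mul, minpoly.aeval, zero_mul]

theorem vanishesAt_of_chi_eq_zero (A : Finset (ZMod N)) (b : ZMod N) (h : chi N A b = 0) :
    VanishesAt A (addOrderOf b) := by
  rw [chi_eq_sum_stdAddChar] at h
  exact fun s hs => sum_stdAddChar_eq_zero_of_addOrderOf_eq A b s hs.symm h

theorem chi_eq_zero_of_vanishesAt (A : Finset (ZMod N)) (b : ZMod N) {m : ℕ}
    (hb : addOrderOf b = m) (h : VanishesAt A m) : chi N A b = 0 := by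
  rw [chi_eq_sum_stdAddChar]; exact h b hb

theorem VanishesAt.sum_eq_zero {A : Finset (ZMod N)} {m : ℕ} (h : VanishesAt A m)
    {f : ZMod N → ℂ} (hf : f ∈ primSpan N m) : ∑ a ∈ A, f a = 0 := by
  induction hf using Submodule.span_induction with
  | mem f hf => obtain ⟨s, hs, rfl⟩ := hf; exact h s hs
  | zero => simp
  | add f g _ _ hf hg => simp [Finset.sum_add_distrib, hf, hg]
  | smul c f _ hf => simp [← Finset.mul_sum, hf]

theorem mul_mem_primSpan {d e : ℕ} (hde : d.Coprime e) {f g : ZMod N → ℂ}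
    (hf : f ∈ primSpan N d) (hg : g ∈ primSpan N e) : f * g ∈ primSpan N (d * e) := by
  induction hf using Submodule.span_induction with
  | mem f hf =>
    obtain ⟨s, hs, rfl⟩ := hf
    induction hg using Submodule.span_induction with
    | mem g hg =>
      obtain ⟨t, ht, rfl⟩ := hg
      refine Submodule.subset_span ⟨s + t, ?_, ?_⟩
      · rw [(AddCommute.all s t).addOrderOf_add_eq_mul_addOrderOf_of_coprime (by rwa [hs, ht]),
          hs, ht]
      · funext a
        simp [add_mul, AddChar.map_add_eq_mul]
    | zero => simp
    | add f g _ _ hf hg => rw [mul_add]; exact Submodule.add_mem _ hf hg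
    | smul c f _ hf => rw [mul_smul_comm]; exact Submodule.smul_mem _ c hf
  | zero => simp
  | add f g _ _ hf hg => rw [add_mul]; exact Submodule.add_mem _ hf hg
  | smul c f _ hf => rw [smul_mul_assoc]; exact Submodule.smul_mem _ c hf

theorem residue_eq_castHom {d : ℕ} (hd : d ∣ N) (a : ZMod N) :
    residue d a = ZMod.castHom hd (ZMod d) a := by
  rw [ZMod.castHom_apply, residue, ZMod.cast_eq_val]

theorem residue_sub {d : ℕ} (hd : d ∣ N) (a b : ZMod N) :
    residue d (a - b) = residue d a - residue d b := by
  simp only [residue_eq_castHom hd, map_sub]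

theorem residue_add {d : ℕ} (hd : d ∣ N) (a b : ZMod N) :
    residue d (a + b) = residue d a + residue d b := by
  simp only [residue_eq_castHom hd, map_add]

theorem residue_eq_iff {d : ℕ} (hd : d ∣ N) (a b : ZMod N) :
    residue d a = residue d b ↔ d ∣ (a - b).val := by
  rw [← residue_eq_zero_iff, residue_sub hd, sub_eq_zero]

theorem residue_surjective {d : ℕ} (hd : d ∣ N) (c : ZMod d) :
    ∃ a : ZMod N, residue d a = c := by
  obtain ⟨a, ha⟩ := ZMod.castHom_surjective hd c
  exact ⟨a, by rw [residue_eq_castHom hd, ha]⟩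

theorem residue_eq_of_dvd {d e : ℕ} (hde : d ∣ e) (he : e ∣ N) {a b : ZMod N}
    (h : residue e a = residue e b) : residue d a = residue d b := by
  rw [residue_eq_iff (hde.trans he)]
  exact hde.trans ((residue_eq_iff he a b).1 h)

theorem natCast_mul_eq_zero_iff {d e : ℕ} (hN : N = d * e) (a : ZMod N) :
    (e : ZMod N) * a = 0 ↔ d ∣ a.val := by
  have he : 0 < e := Nat.pos_of_ne_zero fun h => NeZero.ne N (by rw [hN, h, mul_zero])
  rw [← Nat.mul_dvd_mul_iff_left he, mul_comm e d, ← hN, ← ZMod.natCast_eq_zero_iff,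
    Nat.cast_mul, ZMod.natCast_zmod_val]

/-- Fourier expansion of the indicator of a class modulo `d`. -/
theorem ind_eq_sum {d e : ℕ} (hN : N = d * e) (g a : ZMod N) :
    (d : ℂ) * (ind d (residue d g) a : ℤ) =
      ∑ t ∈ range d, (ZMod.stdAddChar ((t : ZMod N) * (e : ZMod N) * (a - g)) : ℂ) := by
  have hd : d ∣ N := ⟨e, hN⟩
  have hpow : ∀ t : ℕ, (ZMod.stdAddChar ((t : ZMod N) * (e : ZMod N) * (a - g)) : ℂ) =
      ZMod.stdAddChar ((e : ZMod N) * (a - g)) ^ t := by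
    intro t
    rw [← AddChar.map_nsmul_eq_pow, nsmul_eq_mul, mul_assoc]
  simp only [hpow]
  have hiff := residue_eq_iff hd a g
  rw [← natCast_mul_eq_zero_iff hN] at hiff
  by_cases h : residue d a = residue d g
  · rw [hiff.1 h]
    simp [ind, h]
  · have hne : (ZMod.stdAddChar ((e : ZMod N) * (a - g)) : ℂ) ≠ 1 := by
      rw [← AddChar.map_zero_eq_one (ZMod.stdAddChar (N := N))]
      exact fun h' => h (hiff.2 (ZMod.injective_stdAddChar h'))
    have h1 := mul_neg_geom_sum (ZMod.stdAddChar ((e : ZMod N) * (a - g)) : ℂ) d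
    have h2 : (ZMod.stdAddChar ((e : ZMod N) * (a - g)) : ℂ) ^ d = 1 := by
      rw [← AddChar.map_nsmul_eq_pow, nsmul_eq_mul, ← mul_assoc, ← Nat.cast_mul, ← hN]
      simp
    rw [h2, sub_self, mul_eq_zero] at h1
    rw [h1.resolve_left (sub_ne_zero.2 hne.symm)]
    simp [ind, h]

theorem ind_sub_ind_mem_primSpan {d : ℕ} (hd : d ∣ N) (g g' : ZMod N)
    (h : ∀ s : ZMod N, d • s = 0 → addOrderOf s ≠ d → s * (g - g') = 0) :
    (fun a => ((ind d (residue d g) a - ind d (residue d g') a : ℤ) : ℂ)) ∈ primSpan N d := by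
  obtain ⟨e, hN⟩ := hd
  have hd0 : (d : ℂ) ≠ 0 := by
    rw [Nat.cast_ne_zero]
    rintro rfl
    exact NeZero.ne N (by rw [hN, zero_mul])
  have heq : (fun a => ((ind d (residue d g) a - ind d (residue d g') a : ℤ) : ℂ)) =
      (d : ℂ)⁻¹ • ∑ t ∈ range d,
        ((ZMod.stdAddChar (-((t : ZMod N) * (e : ZMod N) * g)) : ℂ) -
          ZMod.stdAddChar (-((t : ZMod N) * (e : ZMod N) * g'))) •
          (fun a : ZMod N => (ZMod.stdAddChar ((t : ZMod N) * (e : ZMod N) * a) : ℂ)) := by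
    funext a
    rw [Pi.smul_apply, Finset.sum_apply, smul_eq_mul, eq_inv_mul_iff_mul_eq₀ hd0]
    push_cast
    rw [mul_sub, ind_eq_sum hN, ind_eq_sum hN, ← Finset.sum_sub_distrib]
    refine Finset.sum_congr rfl fun t _ => ?_
    rw [Pi.smul_apply, smul_eq_mul, sub_mul, ← AddChar.map_add_eq_mul, ← AddChar.map_add_eq_mul]
    congr 2 <;> ring_nf
  rw [heq]
  refine Submodule.smul_mem _ _ (Submodule.sum_mem _ fun t _ => ?_)
  by_cases ho : addOrderOf ((t : ZMod N) * (e : ZMod N)) = d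
  · exact Submodule.smul_mem _ _ (Submodule.subset_span ⟨_, ho, rfl⟩)
  · have hz : d • ((t : ZMod N) * (e : ZMod N)) = 0 := by
      rw [nsmul_eq_mul, mul_left_comm, ← Nat.cast_mul, ← hN]
      simp
    have := h _ hz ho
    rw [mul_sub, sub_eq_zero] at this
    rw [this, sub_self, zero_smul]
    exact Submodule.zero_mem _

theorem ind_sub_ind_mem_primSpan_prime_pow {l k : ℕ} (hl : l.Prime) (hd : l ^ (k + 1) ∣ N)
    (g g' : ZMod N) (h : residue (l ^ k) g = residue (l ^ k) g') :
    (fun a => ((ind (l ^ (k + 1)) (residue _ g) a - ind (l ^ (k + 1)) (residue _ g') a : ℤ) : ℂ))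
      ∈ primSpan N (l ^ (k + 1)) := by
  refine ind_sub_ind_mem_primSpan hd g g' fun s hs ho => ?_
  have : Fact l.Prime := ⟨hl⟩
  have hs' : l ^ k • s = 0 := by
    by_contra hne
    exact ho (addOrderOf_eq_prime_pow hne hs)
  obtain ⟨c, hc⟩ := (residue_eq_iff ((pow_dvd_pow l k.le_succ).trans hd) g g').1 h
  rw [← ZMod.natCast_zmod_val (g - g'), hc, Nat.cast_mul, ← mul_assoc, mul_comm s,
    ← nsmul_eq_mul, hs', zero_mul]

theorem ind_sub_ind_mem_primSpan_prime {l : ℕ} (hl : l.Prime) (hd : l ∣ N) (c c' : ZMod l) :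
    (fun a => ((ind l c a - ind l c' a : ℤ) : ℂ)) ∈ primSpan N l := by
  obtain ⟨g, rfl⟩ := residue_surjective hd c
  obtain ⟨g', rfl⟩ := residue_surjective hd c'
  refine ind_sub_ind_mem_primSpan hd g g' fun s hs ho => ?_
  have : Fact l.Prime := ⟨hl⟩
  have hs' : s = 0 := by
    by_contra hne
    exact ho (addOrderOf_eq_prime hs hne)
  rw [hs', zero_mul]

end Characters

theorem IsSpectralPair.symm {N : ℕ} [NeZero N] {A B : Finset (ZMod N)}
    (h : IsSpectralPair N A B) : IsSpectralPair N B A := by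
  obtain ⟨hcard, hz⟩ := h
  refine ⟨hcard.symm, fun a ha a' ha' hne => ?_⟩
  have hpos : (A.card : ℂ) ≠ 0 := by
    rw [Nat.cast_ne_zero]; exact (Finset.card_pos.2 ⟨a, ha⟩).ne'
  let M : Matrix B A ℂ := fun b a => (A.card : ℂ)⁻¹ * ZMod.stdAddChar ((b : ZMod N) * (a : ZMod N))
  let M' : Matrix A B ℂ := fun a b => ZMod.stdAddChar (-((b : ZMod N) * (a : ZMod N)))
  have h1 : M * M' = 1 := by
    ext b b'
    rw [Matrix.mul_apply, Matrix.one_apply]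
    have hsum : ∑ j : A, M b j * M' j b' =
        (A.card : ℂ)⁻¹ * ∑ a ∈ A, (ZMod.stdAddChar (((b : ZMod N) - (b' : ZMod N)) * a) : ℂ) := by
      rw [← Finset.sum_coe_sort A, Finset.mul_sum]
      refine Finset.sum_congr rfl fun a _ => ?_
      simp only [M, M']
      rw [mul_assoc, ← AddChar.map_add_eq_mul]
      ring_nf
    rw [hsum]
    split_ifs with hbb
    · simp [hbb, hpos]
    · rw [← chi_eq_sum_stdAddChar, hz b b.2 b' b'.2 fun h => hbb (Subtype.ext h), mul_zero]
  have h2 : M' * M = 1 := (Matrix.mul_eq_one_comm_of_card_eq B A ℂ (by simp [hcard])).1 h1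
  have h3 := congrFun (congrFun h2 ⟨a', ha'⟩) ⟨a, ha⟩
  rw [Matrix.mul_apply, Matrix.one_apply, if_neg (fun h => hne (congrArg Subtype.val h).symm)] at h3
  rw [chi_eq_sum_stdAddChar, ← Finset.sum_coe_sort B]
  have h4 : (A.card : ℂ)⁻¹ * ∑ b : B, (ZMod.stdAddChar ((a - a') * (b : ZMod N)) : ℂ) = 0 := by
    rw [← h3, Finset.mul_sum]
    refine Finset.sum_congr rfl fun b _ => ?_
    simp only [M, M']
    rw [mul_left_comm, ← AddChar.map_add_eq_mul]
    ring_nf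
  exact (mul_eq_zero.1 h4).resolve_left (inv_ne_zero hpos)

theorem IsSpectralPair.vanishesAt {N : ℕ} [NeZero N] {A B : Finset (ZMod N)}
    (h : IsSpectralPair N A B) {b b' : ZMod N} (hb : b ∈ B) (hb' : b' ∈ B) (hne : b ≠ b') :
    VanishesAt A (addOrderOf (b - b')) :=
  vanishesAt_of_chi_eq_zero A _ (h.2 b hb b' hb' hne)

/-- The number of elements of `B` on which `f` and `g` take prescribed values. -/
def jointCount {ι α β : Type*} [DecidableEq α] [DecidableEq β] (B : Finset ι) (f : ι → α)
    (g : ι → β) (x : α) (y : β) : ℤ :=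
  ((B.filter fun b => f b = x ∧ g b = y).card : ℤ)

section Counting

variable {ι α β : Type*} [DecidableEq α] [DecidableEq β]

theorem jointCount_nonneg (B : Finset ι) (f : ι → α) (g : ι → β) (x : α) (y : β) :
    0 ≤ jointCount B f g x y := Int.natCast_nonneg _

theorem jointCount_pos_iff (B : Finset ι) (f : ι → α) (g : ι → β) (x : α) (y : β) :
    0 < jointCount B f g x y ↔ ∃ b ∈ B, f b = x ∧ g b = y := by
  rw [jointCount, Int.natCast_pos, Finset.card_pos]
  simp [Finset.Nonempty]

theorem jointCount_eq_zero_iff (B : Finset ι) (f : ι → α) (g : ι → β) (x : α) (y : β) :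
    jointCount B f g x y = 0 ↔ ∀ b ∈ B, f b = x → g b ≠ y := by
  rw [jointCount, Int.natCast_eq_zero, Finset.card_eq_zero, Finset.filter_eq_empty_iff]
  simp

theorem jointCount_comm (B : Finset ι) (f : ι → α) (g : ι → β) (x : α) (y : β) :
    jointCount B f g x y = jointCount B g f y x := by
  simp only [jointCount, and_comm]

theorem sum_jointCount [Fintype β] (B : Finset ι) (f : ι → α) (g : ι → β) (x : α) :
    ∑ y, jointCount B f g x y = ((B.filter fun b => f b = x).card : ℤ) := by
  rw [Finset.card_eq_sum_card_fiberwise (f := g) (t := Finset.univ) (fun _ _ => by simp)]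
  push_cast
  refine Finset.sum_congr rfl fun y _ => ?_
  rw [jointCount, Finset.filter_filter]

theorem sum_card_fiber [Fintype α] (B : Finset ι) (f : ι → α) :
    ∑ x, ((B.filter fun b => f b = x).card : ℤ) = B.card := by
  rw [Finset.card_eq_sum_card_fiberwise (f := f) (t := Finset.univ) (fun _ _ => by simp)]
  push_cast
  rfl

/-- The joint counts of `f` and `g` are a sum of a function of `f` and a function of `g`. -/
def IsAdditiveCount (B : Finset ι) (f : ι → α) (g : ι → β) : Prop :=
  ∀ x x' y y', jointCount B f g x y + jointCount B f g x' y' =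
    jointCount B f g x y' + jointCount B f g x' y

theorem IsAdditiveCount.symm {B : Finset ι} {f : ι → α} {g : ι → β} (h : IsAdditiveCount B f g) :
    IsAdditiveCount B g f := by
  intro x x' y y'
  simp only [jointCount_comm B g f]
  linarith [h y y' x x']

/-- If the marginal of `g` is not constant, some value of `g` occurs with every value of `f`. -/
theorem IsAdditiveCount.exists_full [Fintype α] {B : Finset ι} {f : ι → α} {g : ι → β}
    (h : IsAdditiveCount B f g) {z z' : β}
    (hz : (B.filter fun b => g b = z).card ≠ (B.filter fun b => g b = z').card) :
    ∃ z₀, ∀ x, ∃ b ∈ B, f b = x ∧ g b = z₀ := by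
  wlog hlt : (B.filter fun b => g b = z').card < (B.filter fun b => g b = z).card generalizing z z'
  · exact this hz.symm (lt_of_le_of_ne (not_lt.1 hlt) hz)
  refine ⟨z, fun x => ?_⟩
  rw [← jointCount_pos_iff]
  by_contra hx
  have hx0 : jointCount B f g x z = 0 := le_antisymm (not_lt.1 hx) (jointCount_nonneg _ _ _ _ _)
  have hle : ∀ x', jointCount B g f z x' ≤ jointCount B g f z' x' := by
    intro x'
    rw [jointCount_comm B g f, jointCount_comm B g f]
    linarith [h x x' z z', jointCount_nonneg B f g x z']
  have := Finset.sum_le_sum fun x' (_ : x' ∈ (Finset.univ : Finset α)) => hle x'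
  rw [sum_jointCount, sum_jointCount] at this
  omega

end Counting

/-- Two partial permutation matrices whose difference is a sum of a function of the row and a
function of the column are equal. -/
theorem eq_one_of_partial_permutation {α β : Type*} {e e' : α → β → ℤ}
    (h0 : ∀ y z, 0 ≤ e y z) (h0' : ∀ y z, 0 ≤ e' y z)
    (hrow : ∀ y z z', z ≠ z' → e y z + e y z' ≤ 1)
    (hrow' : ∀ y z z', z ≠ z' → e' y z + e' y z' ≤ 1)
    (hcol : ∀ y y' z, y ≠ y' → e y z + e y' z ≤ 1)
    (hadd : ∀ y y' z z', (e y z - e' y z) + (e y' z' - e' y' z') =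
      (e y z' - e' y z') + (e y' z - e' y' z))
    {y y₂ : α} {z z₂ z₃ : β} (hy : y₂ ≠ y) (hz₂ : z₂ ≠ z) (hz₃ : z₃ ≠ z) (hz : z₂ ≠ z₃)
    (h1 : e y z = 1) : 0 < e' y z := by
  by_contra hneg
  have h2 := hadd y y₂ z z₂
  have h3 := hadd y y₂ z z₃
  linarith [h0 y₂ z, h0 y z₂, h0 y z₃, h0 y₂ z₂, h0 y₂ z₃, h0' y₂ z, h0' y z₂, h0' y z₃, h0' y z,
    hrow y z z₂ hz₂.symm, hrow y z z₃ hz₃.symm, hcol y y₂ z hy.symm, hrow' y₂ z₂ z₃ hz]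

theorem sum_ind_sub_mul_ind_sub {N : ℕ} (A : Finset (ZMod N)) {d e : ℕ} (x x' : ZMod d)
    (y y' : ZMod e) :
    ∑ a ∈ A, (ind d x a - ind d x' a) * (ind e y a - ind e y' a) =
      jointCount A (residue d) (residue e) x y + jointCount A (residue d) (residue e) x' y' -
      jointCount A (residue d) (residue e) x y' - jointCount A (residue d) (residue e) x' y := by
  have key : ∀ x y, jointCount A (residue d) (residue e) x y =
      ∑ a ∈ A, ind d x a * ind e y a := by
    intro x y
    rw [jointCount, Finset.card_filter]
    push_cast
    refine Finset.sum_congr rfl fun a _ => ?_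
    by_cases h1 : residue d a = x <;> by_cases h2 : residue e a = y <;> simp [ind, h1, h2]
  simp only [key, ← Finset.sum_sub_distrib, ← Finset.sum_add_distrib]
  exact Finset.sum_congr rfl fun a _ => by ring

section Vanishing

variable {N : ℕ} [NeZero N]

theorem VanishesAt.sum_mul_eq_zero {A : Finset (ZMod N)} {d e : ℕ} (h : VanishesAt A (d * e))
    (hde : d.Coprime e) {u v : ZMod N → ℤ} (hu : (fun a => (u a : ℂ)) ∈ primSpan N d)
    (hv : (fun a => (v a : ℂ)) ∈ primSpan N e) : ∑ a ∈ A, u a * v a = 0 := by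
  have := h.sum_eq_zero (mul_mem_primSpan hde hu hv)
  simp only [Pi.mul_apply] at this
  exact_mod_cast this

theorem VanishesAt.isAdditiveCount {A : Finset (ZMod N)} {d e : ℕ} (hd : d.Prime) (he : e.Prime)
    (hde : d ≠ e) (hdN : d ∣ N) (heN : e ∣ N) (h : VanishesAt A (d * e)) :
    IsAdditiveCount A (residue d) (residue e) := by
  intro x x' y y'
  have := h.sum_mul_eq_zero ((Nat.coprime_primes hd he).2 hde)
    (ind_sub_ind_mem_primSpan_prime hd hdN x x') (ind_sub_ind_mem_primSpan_prime he heN y y')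
  rw [sum_ind_sub_mul_ind_sub] at this
  linarith

theorem VanishesAt.jointCount_eq {A : Finset (ZMod N)} {p e k : ℕ} (hp : p.Prime) (he : e.Prime)
    (hpe : p ≠ e) (hpN : p ^ (k + 1) ∣ N) (heN : e ∣ N) (h : VanishesAt A (p ^ (k + 1) * e))
    {g g' : ZMod N} (hg : residue (p ^ k) g = residue (p ^ k) g') (y y' : ZMod e) :
    jointCount A (residue (p ^ (k + 1))) (residue e) (residue _ g) y +
      jointCount A (residue (p ^ (k + 1))) (residue e) (residue _ g') y' =
    jointCount A (residue (p ^ (k + 1))) (residue e) (residue _ g) y' +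
      jointCount A (residue (p ^ (k + 1))) (residue e) (residue _ g') y := by
  have := h.sum_mul_eq_zero (((Nat.coprime_primes hp he).2 hpe).pow_left _)
    (ind_sub_ind_mem_primSpan_prime_pow hp hpN g g' hg) (ind_sub_ind_mem_primSpan_prime he heN y y')
  rw [sum_ind_sub_mul_ind_sub] at this
  linarith

theorem VanishesAt.jointCount_eq_of_three {A : Finset (ZMod N)} {p q r k : ℕ} (hp : p.Prime)
    (hq : q.Prime) (hr : r.Prime) (hpq : p ≠ q) (hpr : p ≠ r) (hqr : q ≠ r)
    (hpN : p ^ (k + 1) ∣ N) (hqN : q ∣ N) (hrN : r ∣ N)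
    (h : VanishesAt A (p ^ (k + 1) * q * r))
    {g g' : ZMod N} (hg : residue (p ^ k) g = residue (p ^ k) g') (y y' : ZMod q) (z z' : ZMod r) :
    let e := jointCount (A.filter fun a => residue (p ^ (k + 1)) a = residue _ g)
      (residue q) (residue r)
    let e' := jointCount (A.filter fun a => residue (p ^ (k + 1)) a = residue _ g')
      (residue q) (residue r)
    (e y z - e' y z) + (e y' z' - e' y' z') = (e y z' - e' y z') + (e y' z - e' y' z) := by
  intro e e'
  have hcop : (p ^ (k + 1)).Coprime (q * r) :=
    Nat.Coprime.pow_left _ (Nat.Coprime.mul_right ((Nat.coprime_primes hp hq).2 hpq)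
      ((Nat.coprime_primes hp hr).2 hpr))
  rw [mul_assoc] at h
  have hv : (fun a => (((ind q y a - ind q y' a) * (ind r z a - ind r z' a) : ℤ) : ℂ)) ∈
      primSpan N (q * r) := by
    have := mul_mem_primSpan ((Nat.coprime_primes hq hr).2 hqr)
      (ind_sub_ind_mem_primSpan_prime hq hqN y y') (ind_sub_ind_mem_primSpan_prime hr hrN z z')
    convert this using 1
    funext a
    simp only [Pi.mul_apply]
    push_cast
    ring
  have := h.sum_mul_eq_zero hcop (ind_sub_ind_mem_primSpan_prime_pow hp hpN g g' hg) hv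
  have hsplit : ∀ g : ZMod N, ∑ a ∈ A, ind (p ^ (k + 1)) (residue _ g) a *
      ((ind q y a - ind q y' a) * (ind r z a - ind r z' a)) =
      ∑ a ∈ A.filter fun a => residue (p ^ (k + 1)) a = residue _ g,
        (ind q y a - ind q y' a) * (ind r z a - ind r z' a) := by
    intro g
    rw [Finset.sum_filter]
    refine Finset.sum_congr rfl fun a _ => ?_
    by_cases h1 : residue (p ^ (k + 1)) a = residue _ g <;> simp [ind, h1]
  simp only [sub_mul (ind (p ^ (k + 1)) (residue _ g) _), Finset.sum_sub_distrib, hsplit,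
    sum_ind_sub_mul_ind_sub] at this
  simp only [e, e']
  linarith

end Vanishing

section Orders

variable {p q r n N : ℕ} [NeZero N]

theorem addOrderOf_sub_eq (hp : p.Prime) (hq : q.Prime) (hr : r.Prime) (hpq : p ≠ q) (hpr : p ≠ r)
    (hqr : q ≠ r) (hN : N = p ^ n * q * r) {a b : ZMod N} {i : ℕ} (hi : i ≤ n)
    (h1 : residue (p ^ i) a = residue (p ^ i) b)
    (h2 : i < n → residue (p ^ (i + 1)) a ≠ residue (p ^ (i + 1)) b) :
    addOrderOf (a - b) = p ^ (n - i) * (if residue q a = residue q b then 1 else q) *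
      (if residue r a = residue r b then 1 else r) := by
  have hpn : ∀ j ≤ n, p ^ j ∣ N := fun j hj =>
    (pow_dvd_pow p hj).trans ⟨q * r, by rw [hN, mul_assoc]⟩
  have hqN : q ∣ N := ⟨p ^ n * r, by rw [hN]; ring⟩
  have hrN : r ∣ N := ⟨p ^ n * q, by rw [hN]; ring⟩
  simp only [residue_eq_iff hqN, residue_eq_iff hrN]
  rw [residue_eq_iff (hpn i hi)] at h1
  replace h2 : i < n → ¬ p ^ (i + 1) ∣ (a - b).val := fun h => by
    rw [← residue_eq_iff (hpn _ h)]; exact h2 h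
  have ho := ZMod.addOrderOf_coe (a - b).val (NeZero.ne N)
  rw [ZMod.natCast_zmod_val] at ho
  rw [ho]
  generalize (a - b).val = v at *
  have cpq : (p ^ n).Coprime q := ((Nat.coprime_primes hp hq).2 hpq).pow_left _
  have cpr : (p ^ n).Coprime r := ((Nat.coprime_primes hp hr).2 hpr).pow_left _
  have cqr : q.Coprime r := (Nat.coprime_primes hq hr).2 hqr
  have gp : (p ^ n).gcd v = p ^ i := by
    obtain ⟨j, hj, hj'⟩ := (Nat.dvd_prime_pow hp).1 (Nat.gcd_dvd_left (p ^ n) v)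
    rw [hj']
    have hij : i ≤ j := (Nat.pow_dvd_pow_iff_le_right hp.one_lt).1
      (hj' ▸ Nat.dvd_gcd (pow_dvd_pow p hi) h1)
    have hji : j ≤ i := by
      by_contra hlt
      exact h2 (by omega) ((pow_dvd_pow p (by omega)).trans (hj' ▸ Nat.gcd_dvd_right (p ^ n) v))
    rw [le_antisymm hij hji]
  have gprime : ∀ l : ℕ, l.Prime → l = l.gcd v * (if l ∣ v then 1 else l) := by
    intro l hl
    split_ifs with h
    · rw [Nat.gcd_eq_left h, mul_one]
    · rw [(Nat.Prime.coprime_iff_not_dvd hl).2 h, one_mul]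
  have gN : N.gcd v = p ^ i * q.gcd v * r.gcd v := by
    rw [Nat.gcd_comm, hN, (cpr.mul_left cqr).gcd_mul, cpq.gcd_mul, Nat.gcd_comm v, gp,
      Nat.gcd_comm v, Nat.gcd_comm v]
  refine Nat.div_eq_of_eq_mul_left (Nat.gcd_pos_of_pos_left _ (NeZero.pos N)) ?_
  rw [gN]
  conv_lhs => rw [hN, gprime q hq, gprime r hr, ← Nat.sub_add_cancel hi, pow_add]
  ring

theorem eq_of_residue_eq (hp : p.Prime) (hq : q.Prime) (hr : r.Prime) (hpq : p ≠ q) (hpr : p ≠ r)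
    (hqr : q ≠ r) (hN : N = p ^ n * q * r) {a b : ZMod N}
    (hP : residue (p ^ n) a = residue (p ^ n) b) (hQ : residue q a = residue q b)
    (hR : residue r a = residue r b) : a = b := by
  have := addOrderOf_sub_eq hp hq hr hpq hpr hqr hN le_rfl hP (fun h => absurd h (lt_irrefl _))
  rw [if_pos hQ, if_pos hR, Nat.sub_self, pow_zero, mul_one, mul_one] at this
  exact sub_eq_zero.1 (AddMonoid.addOrderOf_eq_one_iff.1 this)

end Orders

theorem sum_eq_add_card_sub_one_mul {α : Type*} [Fintype α] [DecidableEq α] (F : α → ℤ) (x₀ : α)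
    (c : ℤ) (h : ∀ x, x ≠ x₀ → F x = c) : ∑ x, F x = F x₀ + ((Fintype.card α : ℤ) - 1) * c := by
  rw [← Finset.add_sum_erase _ _ (Finset.mem_univ x₀),
    Finset.sum_congr rfl fun x hx => h x (Finset.ne_of_mem_erase hx), Finset.sum_const,
    Finset.card_erase_of_mem (Finset.mem_univ x₀), nsmul_eq_mul, Finset.card_univ,
    Nat.cast_sub (Fintype.card_pos_iff.2 ⟨x₀⟩), Nat.cast_one]

/-- The cross structure forced on a finite set with three coordinates whose pairwise joint counts
are additive, if points differing in the coordinate `c` must agree in `f` or in `g`. -/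
theorem exists_cross_parameters {ι α β γ : Type*} [Fintype α] [Fintype β] [Fintype γ]
    [DecidableEq α] [DecidableEq β] [DecidableEq γ] {B : Finset ι} {c : ι → γ} {f : ι → α}
    {g : ι → β} (hfg : IsAdditiveCount B f g) (hcf : IsAdditiveCount B c f)
    (hcg : IsAdditiveCount B c g)
    (hf : ∃ y y', (B.filter fun b => f b = y).card ≠ (B.filter fun b => f b = y').card)
    (hg : ∃ z z', (B.filter fun b => g b = z).card ≠ (B.filter fun b => g b = z').card)
    (hgen : ∀ b ∈ B, ∀ b' ∈ B, c b ≠ c b' → f b = f b' ∨ g b = g b')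
    (hc : ∃ b ∈ B, ∃ b' ∈ B, c b ≠ c b') (hα : 1 < Fintype.card α) (hβ : 2 < Fintype.card β) :
    ∃ u v k : ℤ, 0 < k ∧ Fintype.card β * u = Fintype.card γ * k ∧
      Fintype.card α * v = Fintype.card γ * k ∧ (Fintype.card γ - 1) * k ≤ u + v ∧
      (B.card : ℤ) = 2 * (Fintype.card γ * k) ∧
      (∃ z z', ((B.filter fun b => g b = z).card : ℤ) - (B.filter fun b => g b = z').card =
        Fintype.card γ * k) ∧
      ∃ i j, (B.filter fun b => c b = i).card ≠ (B.filter fun b => c b = j).card := by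
  obtain ⟨_, _, hf⟩ := hf
  obtain ⟨_, _, hg⟩ := hg
  obtain ⟨z₀, hz₀⟩ := hfg.exists_full hg
  obtain ⟨y₀, hy₀⟩ := hfg.symm.exists_full hf
  have : Nontrivial α := Fintype.one_lt_card_iff_nontrivial.1 hα
  have : Nontrivial β := Fintype.one_lt_card_iff_nontrivial.1 (by omega)
  obtain ⟨y₁, hy₁⟩ := exists_ne y₀
  obtain ⟨z₁, hz₁⟩ := exists_ne z₀
  obtain ⟨b₁, hb₁, hb₁z, hb₁y⟩ := hy₀ z₁
  obtain ⟨b₂, hb₂, hb₂y, hb₂z⟩ := hz₀ y₁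
  set c₀ := c b₁ with hc₀
  have col : ∀ b ∈ B, f b ≠ y₀ → g b = z₀ → c b = c₀ := by
    intro b hb h1 h2
    by_contra hne
    rcases hgen b hb b₁ hb₁ hne with h | h
    · exact h1 (h.trans hb₁y)
    · exact hz₁ (by rw [← hb₁z, ← h, h2])
  have hcb₂ : c b₂ = c₀ := col b₂ hb₂ (by rwa [hb₂y]) hb₂z
  have row : ∀ b ∈ B, f b = y₀ → g b ≠ z₀ → c b = c₀ := by
    intro b hb h1 h2
    by_contra hne
    rcases hgen b hb b₂ hb₂ (by rwa [hcb₂]) with h | h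
    · exact hy₁ (by rw [← hb₂y, ← h, h1])
    · exact h2 (h.trans hb₂z)
  have off : ∀ b ∈ B, f b ≠ y₀ → g b ≠ z₀ → c b = c₀ := by
    intro b hb h1 h2
    obtain ⟨z', hz'⟩ : ∃ z', z' ∉ ({z₀, g b} : Finset β) := by
      by_contra! hall
      have h3 := Finset.card_le_two (a := z₀) (b := g b)
      rw [Finset.eq_univ_iff_forall.2 hall, Finset.card_univ] at h3
      omega
    rw [Finset.mem_insert, Finset.mem_singleton, not_or] at hz'
    obtain ⟨b', hb', hb'z, hb'y⟩ := hy₀ z'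
    have hcb' : c b' = c₀ := row b' hb' hb'y (by rw [hb'z]; exact hz'.1)
    by_contra hne
    rcases hgen b hb b' hb' (by rwa [hcb']) with h | h
    · exact h1 (h.trans hb'y)
    · exact hz'.2 (by rw [h, hb'z])
  have center : ∀ b ∈ B, c b ≠ c₀ → f b = y₀ ∧ g b = z₀ := by
    intro b hb hne
    by_cases h1 : f b = y₀ <;> by_cases h2 : g b = z₀
    · exact ⟨h1, h2⟩
    · exact absurd (row b hb h1 h2) hne
    · exact absurd (col b hb h1 h2) hne
    · exact absurd (off b hb h1 h2) hne
  obtain ⟨bs, hbs, hcbs⟩ : ∃ b ∈ B, c b ≠ c₀ := by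
    obtain ⟨b, hb, b', hb', hne⟩ := hc
    by_cases h : c b = c₀
    · exact ⟨b', hb', fun h' => hne (h.trans h'.symm)⟩
    · exact ⟨b, hb, h⟩
  have cross : ∀ b ∈ B, f b = y₀ ∨ g b = z₀ := by
    intro b hb
    by_contra! hne
    have hcb := off b hb hne.1 hne.2
    obtain ⟨h1, h2⟩ := center bs hbs hcbs
    rcases hgen b hb bs hbs (by rw [hcb]; exact hcbs.symm) with h | h
    · exact hne.1 (h.trans h1)
    · exact hne.2 (h.trans h2)
  set k : γ → ℤ := fun j => ((B.filter fun b => c b = j).card : ℤ) with hk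
  have hgz : ∀ j, j ≠ c₀ → ∀ z, z ≠ z₀ → jointCount B c g j z = 0 := by
    intro j hj z hz
    rw [jointCount_eq_zero_iff]
    intro b hb hcb hgb
    exact hz (by rw [← hgb, (center b hb (by rwa [hcb])).2])
  have hfz : ∀ j, j ≠ c₀ → ∀ y, y ≠ y₀ → jointCount B c f j y = 0 := by
    intro j hj y hy
    rw [jointCount_eq_zero_iff]
    intro b hb hcb hfb
    exact hy (by rw [← hfb, (center b hb (by rwa [hcb])).1])
  have hgk : ∀ j, j ≠ c₀ → jointCount B c g j z₀ = k j := by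
    intro j hj
    have := sum_jointCount B c g j
    rw [sum_eq_add_card_sub_one_mul _ z₀ 0 (hgz j hj)] at this
    linarith
  have hfk : ∀ j, j ≠ c₀ → jointCount B c f j y₀ = k j := by
    intro j hj
    have := sum_jointCount B c f j
    rw [sum_eq_add_card_sub_one_mul _ y₀ 0 (hfz j hj)] at this
    linarith
  set κ := k (c bs) with hκ
  set u := jointCount B c g c₀ z₁ with hu
  set v := jointCount B c f c₀ y₁ with hv
  have hκpos : 0 < κ := by
    rw [hκ, ← hgk _ hcbs, jointCount_pos_iff]
    exact ⟨bs, hbs, rfl, (center bs hbs hcbs).2⟩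
  have hg0 : jointCount B c g c₀ z₀ = u + κ := by
    have := hcg c₀ (c bs) z₀ z₁
    rw [hgz _ hcbs _ hz₁, hgk _ hcbs] at this
    linarith
  have hf0 : jointCount B c f c₀ y₀ = v + κ := by
    have := hcf c₀ (c bs) y₀ y₁
    rw [hfz _ hcbs _ hy₁, hfk _ hcbs] at this
    linarith
  have hgu : ∀ z, z ≠ z₀ → jointCount B c g c₀ z = u := by
    intro z hz
    have := hcg c₀ (c bs) z₀ z
    rw [hgz _ hcbs _ hz, hgk _ hcbs] at this
    linarith
  have hfv : ∀ y, y ≠ y₀ → jointCount B c f c₀ y = v := by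
    intro y hy
    have := hcf c₀ (c bs) y₀ y
    rw [hfz _ hcbs _ hy, hfk _ hcbs] at this
    linarith
  have hkj : ∀ j, j ≠ c₀ → k j = κ := by
    intro j hj
    have := hcg c₀ j z₀ z₁
    rw [hgz _ hj _ hz₁, hgk _ hj] at this
    linarith
  have hk0g : k c₀ = Fintype.card β * u + κ := by
    have := sum_jointCount B c g c₀
    rw [sum_eq_add_card_sub_one_mul _ z₀ u hgu] at this
    simp only [hk]
    linarith
  have hk0f : k c₀ = Fintype.card α * v + κ := by
    have := sum_jointCount B c f c₀
    rw [sum_eq_add_card_sub_one_mul _ y₀ v hfv] at this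
    simp only [hk]
    linarith
  have hB : (B.card : ℤ) = Fintype.card β * u + Fintype.card γ * κ := by
    rw [← sum_card_fiber B c, sum_eq_add_card_sub_one_mul _ c₀ κ hkj]
    linarith
  have gcount : ∀ z, z ≠ z₀ → ((B.filter fun b => g b = z).card : ℤ) = u := by
    intro z hz
    rw [← sum_jointCount B g c z, sum_eq_add_card_sub_one_mul _ c₀ 0 fun j hj => by
      rw [jointCount_comm, hgz j hj z hz], jointCount_comm, hgu z hz]
    ring
  have fcount : ∀ y, y ≠ y₀ → ((B.filter fun b => f b = y).card : ℤ) = v := by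
    intro y hy
    rw [← sum_jointCount B f c y, sum_eq_add_card_sub_one_mul _ c₀ 0 fun j hj => by
      rw [jointCount_comm, hfz j hj y hy], jointCount_comm, hfv y hy]
    ring
  have g0count : ((B.filter fun b => g b = z₀).card : ℤ) = u + Fintype.card γ * κ := by
    rw [← sum_jointCount B g c z₀, sum_eq_add_card_sub_one_mul _ c₀ κ fun j hj => by
      rw [jointCount_comm, hgk j hj, hkj j hj], jointCount_comm, hg0]
    ring
  have hzero : ∀ y, y ≠ y₀ → ∀ z, z ≠ z₀ → jointCount B f g y z = 0 := by
    intro y hy z hz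
    rw [jointCount_eq_zero_iff]
    intro b hb hfb hgb
    rcases cross b hb with h | h
    · exact hy (hfb.symm.trans h)
    · exact hz (hgb.symm.trans h)
  have harm : ∀ y, y ≠ y₀ → jointCount B f g y z₀ = v := by
    intro y hy
    have := sum_jointCount B f g y
    rw [sum_eq_add_card_sub_one_mul _ z₀ 0 (hzero y hy), fcount y hy] at this
    linarith
  have harm' : jointCount B f g y₀ z₁ = u := by
    have := sum_jointCount B g f z₁
    rw [sum_eq_add_card_sub_one_mul _ y₀ 0 (fun y hy => by
      rw [jointCount_comm, hzero y hy z₁ hz₁]), gcount z₁ hz₁, jointCount_comm] at this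
    linarith
  have hcen : jointCount B f g y₀ z₀ = u + v := by
    have := hfg y₀ y₁ z₀ z₁
    rw [hzero y₁ hy₁ z₁ hz₁, harm y₁ hy₁, harm'] at this
    linarith
  have g0count' : ((B.filter fun b => g b = z₀).card : ℤ) = u + Fintype.card α * v := by
    rw [← sum_jointCount B g f z₀, sum_eq_add_card_sub_one_mul _ y₀ v fun y hy => by
      rw [jointCount_comm, harm y hy], jointCount_comm, hcen]
    ring
  have hle : (Fintype.card γ - 1) * κ ≤ u + v := by
    have h1 := Finset.card_filter_add_card_filter_not (s := B) (fun b => c b = c₀)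
    have h2 : (B.filter fun b => ¬ c b = c₀).card ≤
        (B.filter fun b => f b = y₀ ∧ g b = z₀).card := by
      refine Finset.card_le_card fun b hb => ?_
      rw [Finset.mem_filter] at hb ⊢
      exact ⟨hb.1, center b hb.1 hb.2⟩
    have h3 : ((B.filter fun b => f b = y₀ ∧ g b = z₀).card : ℤ) = u + v := hcen
    have h4 : ((B.filter fun b => c b = c₀).card : ℤ) = Fintype.card β * u + κ := hk0g
    zify at h1 h2
    linarith
  have hγ : 0 < (Fintype.card γ : ℤ) := by exact_mod_cast Fintype.card_pos_iff.2 ⟨c₀⟩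
  have hpos : 0 < (Fintype.card γ : ℤ) * κ := mul_pos hγ hκpos
  refine ⟨u, v, κ, hκpos, by linarith, by linarith, hle, by linarith, ⟨z₀, z₁, ?_⟩,
    c₀, c bs, fun h => ?_⟩
  · rw [g0count, gcount z₁ hz₁]
    ring
  · have : k c₀ = κ := by simp only [hκ, hk, h]
    linarith

section Fibers

variable {N : ℕ} [NeZero N]

theorem VanishesAt.card_fiber_eq {B : Finset (ZMod N)} {l : ℕ} (hl : l.Prime) (hlN : l ∣ N)
    (h : VanishesAt B l) (y y' : ZMod l) :
    (B.filter fun b => residue l b = y).card = (B.filter fun b => residue l b = y').card := by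
  have h0 := h.sum_eq_zero (ind_sub_ind_mem_primSpan_prime hl hlN y y')
  have h1 : ∑ b ∈ B, (ind l y b - ind l y' b) = 0 := by exact_mod_cast h0
  simp only [Finset.sum_sub_distrib, ind, ← Finset.natCast_card_filter] at h1
  omega

theorem vanishesAt_of_card_fiber_eq {B : Finset (ZMod N)} {l : ℕ} (hl : l.Prime) (hlN : l ∣ N)
    (h : ∀ y y' : ZMod l, (B.filter fun b => residue l b = y).card =
      (B.filter fun b => residue l b = y').card) : VanishesAt B l := by
  intro s hs
  have : Fact l.Prime := ⟨hl⟩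
  choose lift hlift using residue_surjective (N := N) hlN
  have hφ : ∀ a b : ZMod N, residue l a = residue l b →
      (ZMod.stdAddChar (s * a) : ℂ) = ZMod.stdAddChar (s * b) := by
    intro a b hab
    obtain ⟨m, hm⟩ := (residue_eq_iff hlN a b).1 hab
    have hsl : l • s = 0 := by rw [← hs]; exact addOrderOf_nsmul_eq_zero s
    have : s * (a - b) = 0 := by
      rw [← ZMod.natCast_zmod_val (a - b), hm, Nat.cast_mul, ← mul_assoc, mul_comm s,
        ← nsmul_eq_mul, hsl, zero_mul]
    rw [mul_sub, sub_eq_zero] at this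
    rw [this]
  have hsum : ∑ y : ZMod l, (ZMod.stdAddChar (s * lift y) : ℂ) = 0 := by
    have hs1 : (ZMod.stdAddChar s : ℂ) ≠ 1 := by
      intro h1
      rw [← AddChar.map_zero_eq_one (ZMod.stdAddChar (N := N))] at h1
      rw [ZMod.injective_stdAddChar h1, addOrderOf_zero] at hs
      exact hl.one_lt.ne hs
    have hshift : ∑ y : ZMod l, (ZMod.stdAddChar (s * lift y) : ℂ) =
        ZMod.stdAddChar s * ∑ y : ZMod l, (ZMod.stdAddChar (s * lift y) : ℂ) := by
      rw [Finset.mul_sum, ← Equiv.sum_comp (Equiv.addRight (residue l (1 : ZMod N)))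
        fun y => (ZMod.stdAddChar (s * lift y) : ℂ)]
      refine Finset.sum_congr rfl fun y _ => ?_
      rw [hφ (lift _) (1 + lift y), mul_add, mul_one, AddChar.map_add_eq_mul]
      rw [hlift, residue_add hlN, hlift, Equiv.coe_addRight, add_comm]
    by_contra hne
    exact hs1 (mul_right_cancel₀ hne (by rw [← hshift, one_mul]))
  rw [← Finset.sum_fiberwise B (residue l)]
  have hfib : ∀ y : ZMod l, ∑ b ∈ B with residue l b = y, (ZMod.stdAddChar (s * b) : ℂ) =
      ((B.filter fun b => residue l b = 0).card : ℂ) * ZMod.stdAddChar (s * lift y) := by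
    intro y
    rw [Finset.sum_congr rfl fun b hb => hφ b (lift y)
      ((Finset.mem_filter.1 hb).2.trans (hlift y).symm), Finset.sum_const, nsmul_eq_mul, h y 0]
  rw [Finset.sum_congr rfl fun y _ => hfib y, ← Finset.mul_sum, hsum, mul_zero]

theorem exists_residue_ne_zero {B : Finset (ZMod N)}
    (hB : AddSubgroup.closure (B : Set (ZMod N)) = ⊤) {d : ℕ} (hd : d ∣ N) (hd1 : 1 < d) :
    ∃ b ∈ B, residue d b ≠ 0 := by
  by_contra! h
  have : Fact (1 < d) := ⟨hd1⟩
  have hle : AddSubgroup.closure (B : Set (ZMod N)) ≤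
      (ZMod.castHom hd (ZMod d)).toAddMonoidHom.ker :=
    (AddSubgroup.closure_le _).2 fun b hb => by
      simpa [AddMonoidHom.mem_ker, residue_eq_castHom hd] using h b hb
  rw [hB] at hle
  have h1 : ZMod.castHom hd (ZMod d) 1 = 0 := hle (AddSubgroup.mem_top 1)
  rw [map_one] at h1
  exact one_ne_zero h1

theorem residue_natCast {d : ℕ} (hd : d ∣ N) (m : ℕ) : residue d (m : ZMod N) = m := by
  rw [residue_eq_castHom hd, map_natCast]

theorem residue_residue {d e : ℕ} [NeZero e] (hde : d ∣ e) (he : e ∣ N) (a : ZMod N) :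
    residue d (residue e a) = residue d a := by
  rw [residue_eq_castHom hde, residue_eq_castHom he, residue_eq_castHom (hde.trans he)]
  exact RingHom.congr_fun (Subsingleton.elim ((ZMod.castHom hde (ZMod d)).comp
    (ZMod.castHom he (ZMod e))) (ZMod.castHom (hde.trans he) (ZMod d))) a

theorem card_filter_residue_eq {p : ℕ} [NeZero p] (j : ℕ) (c : ZMod (p ^ j)) :
    (univ.filter fun x : ZMod (p ^ (j + 1)) => residue (p ^ j) x = c).card = p := by
  have hdvd : p ^ j ∣ p ^ (j + 1) := pow_dvd_pow p j.le_succ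
  have hc : ∀ c', (univ.filter fun x : ZMod (p ^ (j + 1)) => residue (p ^ j) x = c').card =
      (univ.filter fun x : ZMod (p ^ (j + 1)) => residue (p ^ j) x = c).card := by
    intro c'
    simp only [residue_eq_castHom hdvd]
    exact AddMonoidHom.card_fiber_eq_of_mem_range
      (ZMod.castHom hdvd (ZMod (p ^ j))).toAddMonoidHom
      (ZMod.castHom_surjective hdvd c') (ZMod.castHom_surjective hdvd c)
  have h := Finset.card_eq_sum_card_fiberwise (s := (univ : Finset (ZMod (p ^ (j + 1)))))
    (f := residue (p ^ j)) (t := univ) fun _ _ => by simp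
  rw [Finset.sum_congr rfl fun c' _ => hc c', Finset.sum_const, Finset.card_univ, ZMod.card,
    Finset.card_univ, ZMod.card] at h
  exact (Nat.eq_of_mul_eq_mul_left (pow_pos (NeZero.pos p) j) ((pow_succ p j).symm.trans h)).symm

theorem jointCount_residue_eq_sum {β : Type*} [DecidableEq β] {p j : ℕ} [NeZero p]
    (hd : p ^ (j + 1) ∣ N) (B : Finset (ZMod N)) (g : ZMod N → β) (c : ZMod (p ^ j)) (z : β) :
    jointCount B (residue (p ^ j)) g c z =
      ∑ x : ZMod (p ^ (j + 1)) with residue (p ^ j) x = c,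
        jointCount B (residue (p ^ (j + 1))) g x z := by
  simp only [jointCount]
  rw [Finset.card_eq_sum_card_fiberwise (f := residue (p ^ (j + 1)))
    (t := univ.filter fun x : ZMod (p ^ (j + 1)) => residue (p ^ j) x = c)]
  · push_cast
    refine Finset.sum_congr rfl fun x hx => ?_
    rw [Finset.filter_filter]
    congr 2
    refine Finset.filter_congr fun b _ => ?_
    constructor
    · rintro ⟨⟨_, h1⟩, h2⟩
      exact ⟨h2, h1⟩
    · rintro ⟨rfl, h1⟩
      rw [← residue_residue (pow_dvd_pow p j.le_succ) hd]
      exact ⟨⟨(Finset.mem_filter.1 hx).2, h1⟩, rfl⟩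
  · intro b hb
    simp only [Finset.coe_filter, Set.mem_ofPred_eq, Finset.mem_univ, true_and] at hb ⊢
    rw [residue_residue (pow_dvd_pow p j.le_succ) hd, hb.2.1]

end Fibers

/-- A spectral pair in `Z_N`, `N = p ^ (k + 1) * q * r`, whose first member is not periodic under
the subgroup of order `p`, and whose second member contains `0`, generates `Z_N`, and is annihilated
neither by the characters of order `q` nor by those of order `r`. -/
structure IsExceptionalPair (p q r k : ℕ) {N : ℕ} [NeZero N] (A B : Finset (ZMod N)) : Prop where
  prime_p : p.Prime
  prime_q : q.Prime
  prime_r : r.Prime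
  p_ne_q : p ≠ q
  p_ne_r : p ≠ r
  q_ne_r : q ≠ r
  eq_mul : N = p ^ (k + 1) * q * r
  pair : IsSpectralPair N A B
  not_periodic : ¬ IsUnionOfCosets N p A
  zero_mem : (0 : ZMod N) ∈ B
  closure_eq : AddSubgroup.closure (B : Set (ZMod N)) = ⊤
  not_vanishesAt_q : ¬ VanishesAt B q
  not_vanishesAt_r : ¬ VanishesAt B r

namespace IsExceptionalPair

variable {p q r k N : ℕ} [NeZero N] {A B : Finset (ZMod N)}

theorem swap (S : IsExceptionalPair p q r k A B) : IsExceptionalPair p r q k A B where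
  prime_p := S.prime_p
  prime_q := S.prime_r
  prime_r := S.prime_q
  p_ne_q := S.p_ne_r
  p_ne_r := S.p_ne_q
  q_ne_r := S.q_ne_r.symm
  eq_mul := by rw [S.eq_mul]; ring
  pair := S.pair
  not_periodic := S.not_periodic
  zero_mem := S.zero_mem
  closure_eq := S.closure_eq
  not_vanishesAt_q := S.not_vanishesAt_r
  not_vanishesAt_r := S.not_vanishesAt_q

theorem pow_dvd (S : IsExceptionalPair p q r k A B) {j : ℕ} (hj : j ≤ k + 1) : p ^ j ∣ N :=
  (pow_dvd_pow p hj).trans ⟨q * r, by rw [S.eq_mul, mul_assoc]⟩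

theorem p_dvd (S : IsExceptionalPair p q r k A B) : p ∣ N := by
  simpa using S.pow_dvd (j := 1) (by omega)

theorem q_dvd (S : IsExceptionalPair p q r k A B) : q ∣ N :=
  ⟨p ^ (k + 1) * r, by rw [S.eq_mul]; ring⟩

theorem r_dvd (S : IsExceptionalPair p q r k A B) : r ∣ N := S.swap.q_dvd

theorem eq_of_residue (S : IsExceptionalPair p q r k A B) {a b : ZMod N}
    (hP : residue (p ^ (k + 1)) a = residue (p ^ (k + 1)) b) (hQ : residue q a = residue q b)
    (hR : residue r a = residue r b) : a = b :=
  eq_of_residue_eq S.prime_p S.prime_q S.prime_r S.p_ne_q S.p_ne_r S.q_ne_r S.eq_mul hP hQ hR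

theorem addOrderOf_sub (S : IsExceptionalPair p q r k A B) {a b : ZMod N} {i : ℕ} (hi : i ≤ k + 1)
    (h1 : residue (p ^ i) a = residue (p ^ i) b)
    (h2 : i < k + 1 → residue (p ^ (i + 1)) a ≠ residue (p ^ (i + 1)) b) :
    addOrderOf (a - b) = p ^ (k + 1 - i) * (if residue q a = residue q b then 1 else q) *
      (if residue r a = residue r b then 1 else r) :=
  addOrderOf_sub_eq S.prime_p S.prime_q S.prime_r S.p_ne_q S.p_ne_r S.q_ne_r S.eq_mul hi h1 h2

theorem addOrderOf_sub_of_residue_ne (S : IsExceptionalPair p q r k A B) {a b : ZMod N}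
    (h : residue p a ≠ residue p b) :
    addOrderOf (a - b) = p ^ (k + 1) * (if residue q a = residue q b then 1 else q) *
      (if residue r a = residue r b then 1 else r) :=
  S.addOrderOf_sub (Nat.zero_le _)
    (by rw [residue_eq_iff (S.pow_dvd (Nat.zero_le _)), pow_zero]; exact one_dvd _)
    fun _ h' => h (residue_eq_of_dvd (by simp) (S.pow_dvd (by omega)) h')

theorem eq_of_mem (S : IsExceptionalPair p q r k A B) {a a' : ZMod N} (ha : a ∈ A) (ha' : a' ∈ A)
    (hP : residue (p ^ (k + 1)) a = residue (p ^ (k + 1)) a') (hQ : residue q a = residue q a') :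
    a = a' := by
  by_contra hne
  have ho := S.addOrderOf_sub le_rfl hP fun h => absurd h (lt_irrefl _)
  have hR : residue r a ≠ residue r a' := fun h => hne (S.eq_of_residue hP hQ h)
  rw [if_pos hQ, if_neg hR, Nat.sub_self, pow_zero, one_mul, one_mul] at ho
  exact S.not_vanishesAt_r (ho ▸ S.pair.symm.vanishesAt ha ha' hne)

theorem jointCount_le_one (S : IsExceptionalPair p q r k A B) (x : ZMod (p ^ (k + 1)))
    (y : ZMod q) : jointCount A (residue (p ^ (k + 1))) (residue q) x y ≤ 1 := by
  rw [jointCount, Nat.cast_le_one, Finset.card_le_one]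
  intro a ha b hb
  rw [Finset.mem_filter] at ha hb
  exact S.eq_of_mem ha.1 hb.1 (ha.2.1.trans hb.2.1.symm) (ha.2.2.trans hb.2.2.symm)

/-- The failure of periodicity. -/
theorem exists_add_notMem (S : IsExceptionalPair p q r k A B) :
    ∃ a ∈ A, ∃ x ∉ A, residue (p ^ k) x = residue (p ^ k) a ∧ residue q x = residue q a ∧
      residue r x = residue r a := by
  have h := S.not_periodic
  unfold IsUnionOfCosets at h
  push Not at h
  obtain ⟨a, ha, h, hph, hah⟩ := h
  have hd := (natCast_mul_eq_zero_iff (d := p ^ k * q * r) (e := p)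
    (by rw [S.eq_mul]; ring) h).1 hph
  refine ⟨a, ha, a + h, hah, ?_, ?_, ?_⟩
  · rw [residue_eq_iff (S.pow_dvd (by omega)), add_sub_cancel_left]
    exact (Dvd.intro _ (mul_assoc _ _ _).symm).trans hd
  · rw [residue_eq_iff S.q_dvd, add_sub_cancel_left]
    exact Dvd.dvd.trans ⟨p ^ k * r, by ring⟩ hd
  · rw [residue_eq_iff S.r_dvd, add_sub_cancel_left]
    exact (Dvd.intro_left _ rfl).trans hd

theorem not_vanishesAt_three (S : IsExceptionalPair p q r k A B) (hr : 2 < r) :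
    ¬ VanishesAt A (p ^ (k + 1) * q * r) := by
  intro hV
  obtain ⟨a, ha, x, hx, hxp, hxq, hxr⟩ := S.exists_add_notMem
  have : Fact q.Prime := ⟨S.prime_q⟩
  have : Fact r.Prime := ⟨S.prime_r⟩
  obtain ⟨y₂, hy₂⟩ := exists_ne (residue q a)
  have hrow : ∀ (w : ZMod (p ^ (k + 1))) (y : ZMod q) (z z' : ZMod r), z ≠ z' →
      jointCount (A.filter fun a => residue (p ^ (k + 1)) a = w) (residue q) (residue r) y z +
      jointCount (A.filter fun a => residue (p ^ (k + 1)) a = w) (residue q) (residue r) y z'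
        ≤ 1 := by
    intro w y z z' hz
    refine le_trans ?_ (S.jointCount_le_one w y)
    rw [jointCount, jointCount, jointCount, ← Nat.cast_add, Nat.cast_le,
      ← Finset.card_union_of_disjoint]
    · refine Finset.card_le_card fun b => ?_
      simp only [Finset.mem_union, Finset.mem_filter]
      tauto
    · rw [Finset.disjoint_filter]
      rintro b - ⟨_, h1⟩ ⟨_, h2⟩
      exact hz (h1.symm.trans h2)
  have hcol : ∀ (w : ZMod (p ^ (k + 1))) (y y' : ZMod q) (z : ZMod r), y ≠ y' →
      jointCount (A.filter fun a => residue (p ^ (k + 1)) a = w) (residue q) (residue r) y z +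
      jointCount (A.filter fun a => residue (p ^ (k + 1)) a = w) (residue q) (residue r) y' z
        ≤ 1 := by
    intro w y y' z hy
    refine le_trans ?_ (S.swap.jointCount_le_one w z)
    rw [jointCount, jointCount, jointCount, ← Nat.cast_add, Nat.cast_le,
      ← Finset.card_union_of_disjoint]
    · refine Finset.card_le_card fun b => ?_
      simp only [Finset.mem_union, Finset.mem_filter]
      tauto
    · rw [Finset.disjoint_filter]
      rintro b - ⟨h1, _⟩ ⟨h2, _⟩
      exact hy (h1.symm.trans h2)
  obtain ⟨z₂, hz₂⟩ := exists_ne (residue r a)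
  obtain ⟨z₃, hz₃⟩ : ∃ z, z ∉ ({residue r a, z₂} : Finset (ZMod r)) := by
    by_contra! hall
    have h3 := Finset.card_le_two (a := residue r a) (b := z₂)
    rw [Finset.eq_univ_iff_forall.2 hall, Finset.card_univ, ZMod.card] at h3
    omega
  rw [Finset.mem_insert, Finset.mem_singleton, not_or] at hz₃
  have hpos := (jointCount_pos_iff (A.filter fun b => residue (p ^ (k + 1)) b = residue _ a)
    (residue q) (residue r) (residue q a) (residue r a)).2
      ⟨a, Finset.mem_filter.2 ⟨ha, rfl⟩, rfl, rfl⟩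
  have hle := hrow (residue _ a) (residue q a) _ _ hz₂.symm
  have hnn := jointCount_nonneg (A.filter fun b => residue (p ^ (k + 1)) b = residue _ a)
    (residue q) (residue r) (residue q a) z₂
  have := eq_one_of_partial_permutation (fun _ _ => jointCount_nonneg _ _ _ _ _)
    (fun _ _ => jointCount_nonneg _ _ _ _ _) (hrow (residue _ a)) (hrow (residue _ x))
    (hcol (residue _ a))
    (fun y y' z z' => hV.jointCount_eq_of_three S.prime_p S.prime_q S.prime_r S.p_ne_q S.p_ne_r
      S.q_ne_r (S.pow_dvd le_rfl) S.q_dvd S.r_dvd hxp.symm y y' z z')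
    hy₂ hz₂ hz₃.1 (fun h => hz₃.2 h.symm) (by omega)
  obtain ⟨b, hb, hbq, hbr⟩ := (jointCount_pos_iff _ _ _ _ _).1 this
  rw [Finset.mem_filter] at hb
  exact hx (S.eq_of_residue hb.2 (hbq.trans hxq.symm) (hbr.trans hxr.symm) ▸ hb.1)

theorem residue_eq_or_eq (S : IsExceptionalPair p q r k A B)
    (hV : ¬ VanishesAt A (p ^ (k + 1) * q * r)) {b b' : ZMod N} (hb : b ∈ B) (hb' : b' ∈ B)
    (hne : residue p b ≠ residue p b') : residue q b = residue q b' ∨ residue r b = residue r b' := by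
  by_contra! h
  have ho := S.addOrderOf_sub_of_residue_ne hne
  rw [if_neg h.1, if_neg h.2] at ho
  exact hV (ho ▸ S.pair.vanishesAt hb hb' fun h => hne (h ▸ rfl))

theorem vanishesAt_q (S : IsExceptionalPair p q r k A B)
    (hV : ¬ VanishesAt A (p ^ (k + 1) * q * r)) : VanishesAt A (p ^ (k + 1) * q) := by
  by_contra hq
  have key : ∀ b ∈ B, ∀ b' ∈ B, residue p b ≠ residue p b' → residue q b = residue q b' := by
    intro b hb b' hb' hne
    by_contra h
    have hR := (S.residue_eq_or_eq hV hb hb' hne).resolve_left h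
    have ho := S.addOrderOf_sub_of_residue_ne hne
    rw [if_neg h, if_pos hR, mul_one] at ho
    exact hq (ho ▸ S.pair.vanishesAt hb hb' fun h => hne (h ▸ rfl))
  obtain ⟨b, hb, hbp⟩ := exists_residue_ne_zero S.closure_eq S.p_dvd S.prime_p.one_lt
  obtain ⟨c, hc, hcq⟩ := exists_residue_ne_zero S.closure_eq S.q_dvd S.prime_q.one_lt
  have hb0 : residue q b = 0 := by
    rw [key b hb 0 S.zero_mem (by rwa [residue_zero]), residue_zero]
  by_cases hcp : residue p c = 0
  · exact hcq (by rw [key c hc b hb (by rw [hcp]; exact hbp.symm), hb0])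
  · exact hcq (by rw [key c hc 0 S.zero_mem (by rwa [residue_zero]), residue_zero])

theorem not_vanishesAt_swap (hV : ¬ VanishesAt A (p ^ (k + 1) * q * r)) :
    ¬ VanishesAt A (p ^ (k + 1) * r * q) := by
  rwa [mul_right_comm]

theorem exists_mem_residue_eq (S : IsExceptionalPair p q r k A B)
    (hV : ¬ VanishesAt A (p ^ (k + 1) * q * r)) {a x : ZMod N} (ha : a ∈ A)
    (hx : residue (p ^ k) x = residue (p ^ k) a) :
    ∃ a' ∈ A, residue (p ^ (k + 1)) a' = residue (p ^ (k + 1)) x ∧ residue q a' = residue q a := by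
  rw [← jointCount_pos_iff]
  by_contra hneg
  have : NeZero q := ⟨S.prime_q.ne_zero⟩
  have : NeZero r := ⟨S.prime_r.ne_zero⟩
  have hY := (S.vanishesAt_q hV).jointCount_eq S.prime_p S.prime_q S.p_ne_q (S.pow_dvd le_rfl)
    S.q_dvd hx.symm
  have hZ := (S.swap.vanishesAt_q (not_vanishesAt_swap hV)).jointCount_eq S.prime_p S.prime_r
    S.p_ne_r (S.pow_dvd le_rfl) S.r_dvd hx.symm
  have hnn := jointCount_nonneg A (residue (p ^ (k + 1))) (residue q)
  have hnn' := jointCount_nonneg A (residue (p ^ (k + 1))) (residue r)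
  have hpos := (jointCount_pos_iff A (residue (p ^ (k + 1))) (residue q) _ _).2 ⟨a, ha, rfl, rfl⟩
  have hpos' := (jointCount_pos_iff A (residue (p ^ (k + 1))) (residue r) _ _).2 ⟨a, ha, rfl, rfl⟩
  have h1 : ∀ y, jointCount A (residue (p ^ (k + 1))) (residue q) (residue _ a) y = 1 ∧
      jointCount A (residue (p ^ (k + 1))) (residue q) (residue _ x) y = 0 := by
    intro y
    have := hY (residue q a) y
    have := hnn (residue _ x) y
    have := hnn (residue _ x) (residue q a)
    have := S.jointCount_le_one (residue _ a) y
    omega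
  have hempty : ∀ b ∈ A, residue (p ^ (k + 1)) b ≠ residue (p ^ (k + 1)) x := fun b hb hbx =>
    (jointCount_eq_zero_iff _ _ _ _ _).1 (h1 (residue q b)).2 b hb hbx rfl
  have h2 : ∀ z, jointCount A (residue (p ^ (k + 1))) (residue r) (residue _ a) z = 1 := by
    intro z
    have h0 : ∀ z, jointCount A (residue (p ^ (k + 1))) (residue r) (residue _ x) z = 0 := fun z =>
      (jointCount_eq_zero_iff _ _ _ _ _).2 fun b hb hbx => absurd hbx (hempty b hb)
    have := hZ (residue r a) z
    have := h0 z
    have := h0 (residue r a)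
    have := S.swap.jointCount_le_one (residue _ a) z
    omega
  have hq := sum_jointCount A (residue (p ^ (k + 1))) (residue q) (residue _ a)
  have hr := sum_jointCount A (residue (p ^ (k + 1))) (residue r) (residue _ a)
  rw [← hr, Finset.sum_congr rfl fun y _ => (h1 y).1, Finset.sum_congr rfl fun z _ => h2 z] at hq
  simp only [Finset.sum_const, Finset.card_univ, ZMod.card, nsmul_eq_mul, mul_one] at hq
  exact S.q_ne_r (by exact_mod_cast hq)

theorem vanishesAt_right_qr (S : IsExceptionalPair p q r k A B)
    (hV : ¬ VanishesAt A (p ^ (k + 1) * q * r)) : VanishesAt B (q * r) := by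
  obtain ⟨a, ha, x, hx, hxp, hxq, hxr⟩ := S.exists_add_notMem
  obtain ⟨a₁, ha₁, h1p, h1q⟩ := S.exists_mem_residue_eq hV ha hxp
  obtain ⟨a₂, ha₂, h2p, h2r⟩ := S.swap.exists_mem_residue_eq (not_vanishesAt_swap hV) ha hxp
  have hne : a₁ ≠ a₂ := by
    rintro rfl
    exact hx (S.eq_of_residue h1p (h1q.trans hxq.symm) (h2r.trans hxr.symm) ▸ ha₁)
  have hP := h1p.trans h2p.symm
  have ho := S.addOrderOf_sub le_rfl hP fun h => absurd h (lt_irrefl _)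
  rw [if_neg fun h => hne (S.eq_of_mem ha₁ ha₂ hP h),
    if_neg fun h => hne (S.swap.eq_of_mem ha₁ ha₂ hP h), Nat.sub_self, pow_zero, one_mul] at ho
  exact ho ▸ S.pair.symm.vanishesAt ha₁ ha₂ hne

theorem vanishesAt_right_pr (S : IsExceptionalPair p q r k A B)
    (hV : ¬ VanishesAt A (p ^ (k + 1) * q * r)) : VanishesAt B (p * r) := by
  obtain ⟨a, ha, x, hx, hxp, hxq, hxr⟩ := S.exists_add_notMem
  obtain ⟨a₁, ha₁, h1p, h1q⟩ := S.exists_mem_residue_eq hV ha hxp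
  have hR : residue r a₁ ≠ residue r a := fun h =>
    hx (S.eq_of_residue h1p (h1q.trans hxq.symm) (h.trans hxr.symm) ▸ ha₁)
  have hne : a₁ ≠ a := fun h => hR (h ▸ rfl)
  have ho := S.addOrderOf_sub (i := k) (by omega)
    ((residue_eq_of_dvd (pow_dvd_pow p k.le_succ) (S.pow_dvd le_rfl) h1p).trans hxp)
    fun _ h => hne (S.eq_of_mem ha₁ ha h h1q)
  rw [if_pos h1q, if_neg hR, Nat.add_sub_cancel_left, pow_one, mul_one] at ho
  exact ho ▸ S.pair.symm.vanishesAt ha₁ ha hne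

theorem exists_card_fiber_ne (S : IsExceptionalPair p q r k A B) :
    ∃ y y' : ZMod q, (B.filter fun b => residue q b = y).card ≠
      (B.filter fun b => residue q b = y').card := by
  by_contra! h
  exact S.not_vanishesAt_q (vanishesAt_of_card_fiber_eq S.prime_q S.q_dvd h)

/-- The numerical consequences of the cross structure of `B`. -/
theorem exists_parameters (S : IsExceptionalPair p q r k A B) (hqr : q < r) :
    ¬ VanishesAt B p ∧ ∃ s : ℤ, 0 < s ∧ ((p : ℤ) - 1) * (q * r) ≤ p * r + p * q ∧
      (A.card : ℤ) = 2 * (p * q * r * s) ∧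
      ∃ z z' : ZMod r, ((B.filter fun b => residue r b = z).card : ℤ) -
        (B.filter fun b => residue r b = z').card = p * q * r * s := by
  have h2 := S.prime_q.two_le
  have hV := S.not_vanishesAt_three (by omega)
  have : Fact p.Prime := ⟨S.prime_p⟩
  have : Fact q.Prime := ⟨S.prime_q⟩
  have : Fact r.Prime := ⟨S.prime_r⟩
  obtain ⟨b, hb, hbp⟩ := exists_residue_ne_zero S.closure_eq S.p_dvd S.prime_p.one_lt
  obtain ⟨u, v, c, hc, hu, hv, hle, hcard, hz, i, j, hij⟩ :=
    exists_cross_parameters (B := B) (c := residue p) (f := residue q) (g := residue r)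
      ((S.vanishesAt_right_qr hV).isAdditiveCount S.prime_q S.prime_r S.q_ne_r S.q_dvd S.r_dvd)
      ((S.swap.vanishesAt_right_pr (not_vanishesAt_swap hV)).isAdditiveCount S.prime_p S.prime_q
        S.p_ne_q S.p_dvd S.q_dvd)
      ((S.vanishesAt_right_pr hV).isAdditiveCount S.prime_p S.prime_r S.p_ne_r S.p_dvd S.r_dvd)
      S.exists_card_fiber_ne S.swap.exists_card_fiber_ne
      (fun b hb b' hb' => S.residue_eq_or_eq hV hb hb')
      ⟨b, hb, 0, S.zero_mem, by rwa [residue_zero]⟩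
      (by rw [ZMod.card]; omega) (by rw [ZMod.card]; omega)
  simp only [ZMod.card] at hu hv hle hcard hz
  refine ⟨fun h => hij (h.card_fiber_eq S.prime_p S.p_dvd i j), ?_⟩
  have hcop : ∀ {x y : ℕ}, x.Prime → y.Prime → x ≠ y → IsCoprime (x : ℤ) y := fun hx hy hxy =>
    Nat.isCoprime_iff_coprime.2 ((Nat.coprime_primes hx hy).2 hxy)
  have hrc : (r : ℤ) ∣ c :=
    (hcop S.prime_r S.prime_p S.p_ne_r.symm).dvd_of_dvd_mul_left ⟨u, hu.symm⟩
  have hqc : (q : ℤ) ∣ c :=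
    (hcop S.prime_q S.prime_p S.p_ne_q.symm).dvd_of_dvd_mul_left ⟨v, hv.symm⟩
  obtain ⟨s, rfl⟩ := (hcop S.prime_q S.prime_r S.q_ne_r).mul_dvd hqc hrc
  have hq0 : (0 : ℤ) < q := by exact_mod_cast S.prime_q.pos
  have hr0 : (0 : ℤ) < r := by exact_mod_cast S.prime_r.pos
  have hs : 0 < s := pos_of_mul_pos_right hc (by positivity)
  have hu' : u = p * q * s := mul_left_cancel₀ hr0.ne' (by rw [hu]; ring)
  have hv' : v = p * r * s := mul_left_cancel₀ hq0.ne' (by rw [hv]; ring)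
  refine ⟨s, hs, ?_, ?_, ?_⟩
  · rw [hu', hv'] at hle
    refine le_of_mul_le_mul_right ?_ hs
    linarith
  · rw [S.pair.1, hcard]; ring
  · obtain ⟨z, z', hz⟩ := hz
    exact ⟨z, z', by rw [hz]; ring⟩

theorem exists_mem_residue_ne (S : IsExceptionalPair p q r k A B)
    (hV : ¬ VanishesAt A (p ^ (k + 1) * q * r)) (hp : ¬ VanishesAt B p) {a : ZMod N} (ha : a ∈ A) :
    ∃ a' ∈ A, residue (p ^ k) a' = residue (p ^ k) a ∧ residue q a' = residue q a ∧
      residue r a' ≠ residue r a := by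
  have hk := S.pow_dvd (Nat.le_succ k)
  have hk' := S.pow_dvd le_rfl
  have hx : residue (p ^ k) (a + ((p ^ k : ℕ) : ZMod N)) = residue (p ^ k) a := by
    rw [residue_add hk, residue_natCast hk, ZMod.natCast_self, add_zero]
  obtain ⟨a', ha', h1, h2⟩ := S.exists_mem_residue_eq hV ha hx
  have hne : residue (p ^ (k + 1)) a' ≠ residue (p ^ (k + 1)) a := by
    rw [h1, residue_add hk', residue_natCast hk', Ne, add_eq_left, ZMod.natCast_eq_zero_iff,
      Nat.pow_dvd_pow_iff_le_right S.prime_p.one_lt]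
    omega
  have hk1 := (residue_eq_of_dvd (pow_dvd_pow p k.le_succ) hk' h1).trans hx
  refine ⟨a', ha', hk1, h2, fun h => hp ?_⟩
  have ho := S.addOrderOf_sub k.le_succ hk1 fun _ => hne
  rw [if_pos h2, if_pos h, Nat.add_sub_cancel_left, pow_one, mul_one, mul_one] at ho
  exact ho ▸ S.pair.symm.vanishesAt ha' ha fun h => hne (h ▸ rfl)

theorem p_lt_r (S : IsExceptionalPair p q r k A B)
    (hV : ¬ VanishesAt A (p ^ (k + 1) * q * r)) (hp : ¬ VanishesAt B p) : p < r := by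
  refine lt_of_le_of_ne ?_ S.p_ne_r
  have : NeZero p := ⟨S.prime_p.ne_zero⟩
  have : NeZero r := ⟨S.prime_r.ne_zero⟩
  obtain ⟨a, ha, -⟩ := S.exists_add_notMem
  have hk' := S.pow_dvd le_rfl
  have hdvd := pow_dvd_pow p k.le_succ
  have key : ∀ c : ZMod (p ^ (k + 1)), ∃ a', residue (p ^ k) c = residue (p ^ k) a → a' ∈ A ∧
      residue (p ^ (k + 1)) a' = c ∧ residue q a' = residue q a := by
    intro c
    by_cases hc : residue (p ^ k) c = residue (p ^ k) a
    · obtain ⟨x, rfl⟩ := residue_surjective hk' c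
      rw [residue_residue hdvd hk'] at hc
      obtain ⟨a', ha', h1, h2⟩ := S.exists_mem_residue_eq hV ha hc
      exact ⟨a', fun _ => ⟨ha', h1, h2⟩⟩
    · exact ⟨a, fun h => absurd h hc⟩
  choose φ hφ using key
  have hφk : ∀ c, residue (p ^ k) c = residue (p ^ k) a →
      residue (p ^ k) (φ c) = residue (p ^ k) a := fun c hc => by
    rw [← residue_residue hdvd hk', (hφ c hc).2.1, hc]
  rw [← card_filter_residue_eq k (residue (p ^ k) a), ← ZMod.card r, ← Finset.card_univ]
  refine Finset.card_le_card_of_injOn (fun c => residue r (φ c)) (fun _ _ => by simp) ?_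
  intro c hc c' hc' heq
  rw [Finset.mem_coe, Finset.mem_filter] at hc hc'
  obtain ⟨h1, h2, h3⟩ := hφ c hc.2
  obtain ⟨h1', h2', h3'⟩ := hφ c' hc'.2
  by_contra hne
  have ho := S.addOrderOf_sub (a := φ c) (b := φ c') k.le_succ
    ((hφk c hc.2).trans (hφk c' hc'.2).symm)
    (fun _ => by rwa [h2, h2'])
  rw [if_pos (h3.trans h3'.symm), if_pos heq, Nat.add_sub_cancel_left, pow_one, mul_one, mul_one] at ho
  exact hp (ho ▸ S.pair.symm.vanishesAt h1 h1' fun h => hne (by rw [← h2, ← h2', h]))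

theorem vanishesAt_right_pow_mul (S : IsExceptionalPair p q r k A B)
    (hV : ¬ VanishesAt A (p ^ (k + 1) * q * r)) (hp : ¬ VanishesAt B p) (hq : q = 3) {i : ℕ}
    (hi : i < k) {a b : ZMod N} (ha : a ∈ A) (hb : b ∈ A)
    (h1 : residue (p ^ i) a = residue (p ^ i) b)
    (h2 : residue (p ^ (i + 1)) a ≠ residue (p ^ (i + 1)) b) :
    VanishesAt B (p ^ (k + 1 - i) * r) := by
  have : NeZero q := ⟨S.prime_q.ne_zero⟩
  have hk := S.pow_dvd k.le_succ
  have hdvd := pow_dvd_pow p hi.le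
  have hdvd' := pow_dvd_pow p hi
  obtain ⟨a', ha', h1a, -, h3a⟩ := S.swap.exists_mem_residue_ne (not_vanishesAt_swap hV) hp ha
  obtain ⟨b', hb', h1b, -, h3b⟩ := S.swap.exists_mem_residue_ne (not_vanishesAt_swap hV) hp hb
  obtain ⟨c, hc, d, hd, hca, hdb, hcd⟩ : ∃ c ∈ A, ∃ d ∈ A,
      residue (p ^ k) c = residue (p ^ k) a ∧ residue (p ^ k) d = residue (p ^ k) b ∧
      residue q c = residue q d := by
    by_contra! h
    have e1 := h a ha b hb rfl rfl
    have e2 := h a ha b' hb' rfl h1b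
    have e3 := h a' ha' b hb h1a rfl
    have e4 := h a' ha' b' hb' h1a h1b
    have hcard := Finset.card_le_univ
      ({residue q a, residue q a', residue q b, residue q b'} : Finset (ZMod q))
    rw [ZMod.card, Finset.card_insert_of_notMem, Finset.card_insert_of_notMem,
      Finset.card_insert_of_notMem, Finset.card_singleton] at hcard
    · omega
    · simpa using h3b.symm
    · simp [e3, e4]
    · simp [e1, e2, h3a.symm]
  obtain ⟨c', hc', h1c, h2c, h3c⟩ := S.exists_mem_residue_ne hV hp hc
  obtain ⟨w, hw, hwa, hwq, hwr⟩ : ∃ w ∈ A, residue (p ^ k) w = residue (p ^ k) a ∧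
      residue q w = residue q d ∧ residue r w ≠ residue r d := by
    by_cases h : residue r c = residue r d
    · exact ⟨c', hc', h1c.trans hca, h2c.trans hcd, h ▸ h3c⟩
    · exact ⟨c, hc, hca, hcd, h⟩
  have ho := S.addOrderOf_sub (a := w) (b := d) (i := i) (by omega)
    (by rw [residue_eq_of_dvd hdvd hk hwa, h1, residue_eq_of_dvd hdvd hk hdb])
    (fun _ => by rwa [residue_eq_of_dvd hdvd' hk hwa, residue_eq_of_dvd hdvd' hk hdb])
  rw [if_pos hwq, if_neg hwr, mul_one] at ho
  exact ho ▸ S.pair.symm.vanishesAt hw hd fun h => hwr (h ▸ rfl)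

theorem exists_pow_dvd_sub (S : IsExceptionalPair p q r k A B)
    (h : ∀ i ≤ k, VanishesAt B (p ^ (k + 1 - i) * r) ∨ ∀ a ∈ A, ∀ b ∈ A,
      residue (p ^ i) a = residue (p ^ i) b → residue (p ^ (i + 1)) a = residue (p ^ (i + 1)) b)
    (z z' : ZMod r) {i : ℕ} (hi : i ≤ k + 1) :
    ∃ E : ℕ, (A.image (residue (p ^ i))).card ≤ p ^ E ∧ ∀ j, j + i = k + 1 → ∀ c : ZMod (p ^ j),
      (p : ℤ) ^ E ∣ jointCount B (residue (p ^ j)) (residue r) c z -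
        jointCount B (residue (p ^ j)) (residue r) c z' := by
  have : NeZero p := ⟨S.prime_p.ne_zero⟩
  induction i with
  | zero =>
    refine ⟨0, ?_, fun _ _ _ => by rw [pow_zero]; exact one_dvd _⟩
    refine (Finset.card_le_univ _).trans ?_
    rw [ZMod.card]
  | succ i ih =>
    obtain ⟨E, hE, hdvd⟩ := ih (by omega)
    have hpi : p ^ i ∣ p ^ (i + 1) := pow_dvd_pow p i.le_succ
    have himage : (A.image (residue (p ^ (i + 1)))).image (residue (p ^ i)) =
        A.image (residue (p ^ i)) := by
      rw [Finset.image_image]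
      exact Finset.image_congr fun a _ => residue_residue hpi (S.pow_dvd hi) a
    rcases h i (by omega) with hB | hA
    · refine ⟨E + 1, ?_, fun j hj c => ?_⟩
      · rw [pow_succ' p E]
        refine le_trans ?_ (Nat.mul_le_mul_left p hE)
        rw [← himage]
        refine Finset.card_le_mul_card_image _ p fun c _ => ?_
        exact (Finset.card_le_card (Finset.filter_subset_filter _ (Finset.subset_univ _))).trans_eq
          (card_filter_residue_eq i c)
      · have hj' : k + 1 - i = j + 1 := by omega
        rw [hj'] at hB
        have hjN := S.pow_dvd (j := j + 1) (by omega)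
        rw [jointCount_residue_eq_sum hjN, jointCount_residue_eq_sum hjN, ← Finset.sum_sub_distrib]
        obtain ⟨g, rfl⟩ := residue_surjective ((pow_dvd_pow p j.le_succ).trans hjN) c
        have hconst : ∀ x ∈ (univ : Finset (ZMod (p ^ (j + 1)))).filter
            (fun x => residue (p ^ j) x = residue (p ^ j) g),
            jointCount B (residue (p ^ (j + 1))) (residue r) x z -
              jointCount B (residue (p ^ (j + 1))) (residue r) x z' =
            jointCount B (residue (p ^ (j + 1))) (residue r) (residue _ g) z -
              jointCount B (residue (p ^ (j + 1))) (residue r) (residue _ g) z' := by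
          intro x hx
          obtain ⟨x, rfl⟩ := residue_surjective hjN x
          rw [Finset.mem_filter, residue_residue (pow_dvd_pow p j.le_succ) hjN] at hx
          linarith [hB.jointCount_eq S.prime_p S.prime_r S.p_ne_r hjN S.r_dvd hx.2 z z']
        rw [Finset.sum_congr rfl hconst, Finset.sum_const, card_filter_residue_eq, nsmul_eq_mul,
          pow_succ']
        exact mul_dvd_mul_left _ (hdvd (j + 1) (by omega) _)
    · refine ⟨E, ?_, fun j hj c => ?_⟩
      · rw [← himage, Finset.card_image_of_injOn] at hE
        · exact hE
        · intro x hx y hy hxy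
          obtain ⟨a, ha, rfl⟩ := Finset.mem_image.1 (Finset.mem_coe.1 hx)
          obtain ⟨b, hb, rfl⟩ := Finset.mem_image.1 (Finset.mem_coe.1 hy)
          rw [residue_residue hpi (S.pow_dvd hi), residue_residue hpi (S.pow_dvd hi)] at hxy
          exact hA a ha b hb hxy
      · have hjN := S.pow_dvd (j := j + 1) (by omega)
        rw [jointCount_residue_eq_sum hjN, jointCount_residue_eq_sum hjN, ← Finset.sum_sub_distrib]
        exact Finset.dvd_sum fun x _ => hdvd (j + 1) (by omega) x

theorem card_le_mul (S : IsExceptionalPair p q r k A B) :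
    A.card ≤ q * (A.image (residue (p ^ (k + 1)))).card := by
  have : NeZero q := ⟨S.prime_q.ne_zero⟩
  refine Finset.card_le_mul_card_image _ q fun x _ => ?_
  have h := sum_jointCount A (residue (p ^ (k + 1))) (residue q) x
  have h' := Finset.sum_le_sum fun y (_ : y ∈ univ) => S.jointCount_le_one x y
  rw [h, Finset.sum_const, Finset.card_univ, ZMod.card, nsmul_eq_mul, mul_one] at h'
  exact_mod_cast h'

theorem false_of_lt (S : IsExceptionalPair p q r k A B) (hqr : q < r) : False := by
  have hq2 := S.prime_q.two_le
  have hp2 := S.prime_p.two_le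
  have hV := S.not_vanishesAt_three (by omega)
  obtain ⟨hp, s, hs, hle, hcard, z, z', hz⟩ := S.exists_parameters hqr
  have hpq : p < q := S.swap.p_lt_r (not_vanishesAt_swap hV) hp
  have hq3 : q = 3 := by
    by_contra hne
    have h4 : (4 : ℤ) ≤ q := by exact_mod_cast (show 4 ≤ q by omega)
    have h5 : (5 : ℤ) ≤ r := by exact_mod_cast (show 5 ≤ r by omega)
    have hp2' : (2 : ℤ) ≤ p := by exact_mod_cast hp2
    have h6 : 2 * ((q : ℤ) + r) < q * r := by nlinarith
    nlinarith
  obtain ⟨E, hE, hdvd⟩ := S.exists_pow_dvd_sub (i := k + 1) (fun i hi => by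
    rcases hi.lt_or_eq with hi | rfl
    · by_contra! h
      obtain ⟨h1, a, ha, b, hb, hab, hab'⟩ := h
      exact h1 (S.vanishesAt_right_pow_mul hV hp hq3 hi ha hb hab hab')
    · left
      rw [Nat.add_sub_cancel_left, pow_one]
      exact S.vanishesAt_right_pr hV) z z' le_rfl
  have hmarg : ∀ w : ZMod r, jointCount B (residue (p ^ 0)) (residue r) 0 w =
      ((B.filter fun b => residue r b = w).card : ℤ) := by
    intro w
    have h0 : ∀ b : ZMod N, residue (p ^ 0) b = 0 := fun b => by
      rw [residue_eq_zero_iff, pow_zero]; exact one_dvd _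
    simp only [jointCount, h0, true_and]
  have hpE := hdvd 0 (zero_add _) 0
  rw [hmarg, hmarg, hz] at hpE
  have hcop : ∀ {l : ℕ}, l.Prime → p ≠ l → IsCoprime ((p : ℤ) ^ E) (l : ℤ) := fun hl hpl =>
    (Nat.isCoprime_iff_coprime.2 ((Nat.coprime_primes S.prime_p hl).2 hpl)).pow_left
  have hps : (p : ℤ) ^ E ∣ p * s := by
    refine (hcop S.prime_q S.p_ne_q).dvd_of_dvd_mul_left
      ((hcop S.prime_r S.p_ne_r).dvd_of_dvd_mul_left ?_)
    rwa [show (r : ℤ) * (q * (p * s)) = p * q * r * s by ring]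
  have hp0 : (0 : ℤ) < p := by omega
  have hEs := Int.le_of_dvd (by positivity) hps
  have h1 : (A.card : ℤ) ≤ q * p ^ E := by
    exact_mod_cast S.card_le_mul.trans (Nat.mul_le_mul_left q hE)
  have h2 : (q : ℤ) * p ^ E ≤ q * (p * s) := mul_le_mul_of_nonneg_left hEs (by positivity)
  have h3 : (0 : ℤ) < q * (p * s) := by
    have : (0 : ℤ) < q := by omega
    positivity
  have h4 : (A.card : ℤ) = 2 * r * (q * (p * s)) := by rw [hcard]; ring
  have h5 : (3 : ℤ) < r := by omega
  nlinarith

protected theorem false (S : IsExceptionalPair p q r k A B) : False := by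
  rcases S.q_ne_r.lt_or_gt with h | h
  · exact S.false_of_lt h
  · exact S.swap.false_of_lt h

end IsExceptionalPair

theorem J2_nonempty (p q r n : ℕ) (hp : p.Prime) (hq : q.Prime) (hr : r.Prime)
    (hpq : p ≠ q) (hpr : p ≠ r) (hqr : q ≠ r) (hn : 0 < n)
    (N : ℕ) (hN : N = p ^ n * q * r)
    (A B : Finset (ZMod N)) (hAB : IsSpectralPair N A B)
    (hA1 : 1 < A.card) (hA2 : A.card < N)
    (h0A : (0 : ZMod N) ∈ A) (h0B : (0 : ZMod N) ∈ B)
    (hgenA : AddSubgroup.closure (A : Set (ZMod N)) = ⊤)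
    (hgenB : AddSubgroup.closure (B : Set (ZMod N)) = ⊤)
    (hcosP : ¬ IsUnionOfCosets N p A) (hcosQ : ¬ IsUnionOfCosets N q A)
    (hcosR : ¬ IsUnionOfCosets N r A)
    (hnotile : ¬ Tiles N A) :
    chi N B ((p ^ n * q : ℕ) : ZMod N) = 0 ∨ chi N B ((p ^ n * r : ℕ) : ZMod N) = 0 := by
  obtain ⟨k, rfl⟩ := Nat.exists_eq_add_one.2 hn
  have hN0 : NeZero N := ⟨by
    rw [hN]
    exact mul_ne_zero (mul_ne_zero (pow_ne_zero _ hp.ne_zero) hq.ne_zero) hr.ne_zero⟩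
  have horder : ∀ {m l : ℕ}, N = m * l → addOrderOf (m : ZMod N) = l := by
    intro m l h
    have hm : 0 < m := Nat.pos_of_ne_zero fun h0 => NeZero.ne N (by rw [h, h0, zero_mul])
    rw [ZMod.addOrderOf_coe _ (NeZero.ne N), h, Nat.gcd_mul_right_left, Nat.mul_div_cancel_left _ hm]
  by_contra! h
  have S : IsExceptionalPair p q r k A B :=
    { prime_p := hp
      prime_q := hq
      prime_r := hr
      p_ne_q := hpq
      p_ne_r := hpr
      q_ne_r := hqr
      eq_mul := hN
      pair := hAB
      not_periodic := hcosP
      zero_mem := h0B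
      closure_eq := hgenB
      not_vanishesAt_q := fun hv =>
        h.2 (chi_eq_zero_of_vanishesAt B _ (horder (by rw [hN]; ring)) hv)
      not_vanishesAt_r := fun hv =>
        h.1 (chi_eq_zero_of_vanishesAt B _ (horder hN) hv) }
  exact S.false
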